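/- Let n be a natural number and let Π : Fin n → Fin n → ((Fin n → ℝ) → ℝ) be a family of smooth functions that is antisymmetric in its indices (Π i j = -Π j i). Define the bracket of smooth functions f, g : (Fin n → ℝ) → ℝ by {f,g} := Σ_{i,j} (Π i j) · (∂_i f) · (∂_j g), where ∂_i denotes the partial derivative along the i-th coordinate. Then for all smooth functions f, g, h : (Fin n → ℝ) → ℝ and every point x, the cyclic sum {f,{g,h}}(x) + {g,{h,f}}(x) + {h,{f,g}}(x) equals Σ_{i,j,k} J^{ijk}(x) · ∂_i f(x) · ∂_j g(x) · ∂_k h(x), where J^{ijk} := Σ_l ( Π i l · ∂_l(Π j k) + Π j l · ∂_l(Π k i) + Π k l · ∂_l(Π i j) ); in particular all second-derivative contributions cancel and the Jacobiator is given by the coordinate expression of one half the Schouten bracket [Π,Π]. -/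

import Mathlib

/-- Partial derivative of `f : (Fin n → ℝ) → ℝ` along the `i`-th standard
coordinate direction. -/
noncomputable def pderiv' {n : ℕ} (i : Fin n) (f : (Fin n → ℝ) → ℝ)
    (x : Fin n → ℝ) : ℝ :=
  fderiv ℝ f x (Pi.single i 1)

/-- The bracket associated to a bivector field `P` in coordinates:
`{f,g} := Σ_{i,j} P i j · ∂_i f · ∂_j g`. -/
noncomputable def pbracket {n : ℕ} (P : Fin n → Fin n → ((Fin n → ℝ) → ℝ))
    (f g : (Fin n → ℝ) → ℝ) (x : Fin n → ℝ) : ℝ :=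
  ∑ i, ∑ j, P i j x * pderiv' i f x * pderiv' j g x

theorem sum_reverse_four {n : ℕ} (F : Fin n → Fin n → Fin n → Fin n → ℝ) :
    ∑ i, ∑ j, ∑ k, ∑ l, F i j k l = ∑ i, ∑ j, ∑ k, ∑ l, F l k j i := by
  simp only [← Fintype.sum_prod_type']
  exact Fintype.sum_equiv
    ⟨fun p => (p.2.2.2, p.2.2.1, p.2.1, p.1), fun p => (p.2.2.2, p.2.2.1, p.2.1, p.1),
      fun _ => rfl, fun _ => rfl⟩ _ _ fun _ => rfl

theorem sum_rotate_three {n : ℕ} (F : Fin n → Fin n → Fin n → ℝ) :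
    ∑ i, ∑ j, ∑ k, F i j k = ∑ i, ∑ j, ∑ k, F k i j := by
  rw [Finset.sum_comm]
  exact Finset.sum_congr rfl fun _ _ => Finset.sum_comm

theorem ContDiff.differentiable_pderiv' {n : ℕ} {f : (Fin n → ℝ) → ℝ}
    (hf : ContDiff ℝ (⊤ : ℕ∞) f) (i : Fin n) : Differentiable ℝ (pderiv' i f) := by
  have : Differentiable ℝ (fderiv ℝ f) :=
    (hf.fderiv_right (m := 1) (by norm_cast)).differentiable (by norm_num)
  exact fun y => (this y).clm_apply (differentiableAt_const _)

theorem pderiv'_comm {n : ℕ} {f : (Fin n → ℝ) → ℝ} (hf : ContDiff ℝ (⊤ : ℕ∞) f)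
    (i j : Fin n) (x : Fin n → ℝ) :
    pderiv' i (pderiv' j f) x = pderiv' j (pderiv' i f) x := by
  have hd : DifferentiableAt ℝ (fderiv ℝ f) x :=
    ((hf.fderiv_right (m := 1) (by norm_cast)).differentiable (by norm_num)) x
  have key (a b : Fin n) : pderiv' a (pderiv' b f) x
      = fderiv ℝ (fderiv ℝ f) x (Pi.single a 1) (Pi.single b 1) := by
    change fderiv ℝ (fun y => fderiv ℝ f y (Pi.single b 1)) x (Pi.single a 1) = _
    rw [fderiv_clm_apply hd (differentiableAt_const _)]
    simp
  rw [key, key]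
  exact (hf.contDiffAt.isSymmSndFDerivAt (by
    rw [minSmoothness_of_isRCLikeNormedField]; exact WithTop.coe_le_coe.2 le_top)) _ _

/-- Leibniz rule for a coordinate derivative of the bracket. -/
theorem pderiv'_pbracket {n : ℕ} {P : Fin n → Fin n → ((Fin n → ℝ) → ℝ)}
    (hP : ∀ i j, ContDiff ℝ (⊤ : ℕ∞) (P i j)) {g h : (Fin n → ℝ) → ℝ}
    (hg : ContDiff ℝ (⊤ : ℕ∞) g) (hh : ContDiff ℝ (⊤ : ℕ∞) h) (l : Fin n) (x : Fin n → ℝ) :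
    pderiv' l (pbracket P g h) x = ∑ j, ∑ k,
      (pderiv' l (P j k) x * pderiv' j g x * pderiv' k h x
        + P j k x * pderiv' l (pderiv' j g) x * pderiv' k h x
        + P j k x * pderiv' j g x * pderiv' l (pderiv' k h) x) := by
  have hterm (j k : Fin n) := ((((hP j k).differentiable (by simp) x).hasFDerivAt.mul
    (hg.differentiable_pderiv' j x).hasFDerivAt).mul (hh.differentiable_pderiv' k x).hasFDerivAt)
  have hsum := HasFDerivAt.fun_sum (u := Finset.univ) fun j _ =>
    HasFDerivAt.fun_sum (u := Finset.univ) fun k _ => hterm j k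
  have hfd : fderiv ℝ (pbracket P g h) x = _ := hsum.fderiv
  rw [pderiv', hfd]
  simp only [sum_apply, add_apply,
    smul_apply, smul_eq_mul, Pi.mul_apply]
  refine Finset.sum_congr rfl fun j _ => Finset.sum_congr rfl fun k _ => ?_
  simp only [← pderiv'.eq_def]
  ring

/-- The part of `{f,{g,h}}` in which the bivector field is differentiated. -/
noncomputable def firstOrderTerm {n : ℕ} (P : Fin n → Fin n → ((Fin n → ℝ) → ℝ))
    (f g h : (Fin n → ℝ) → ℝ) (x : Fin n → ℝ) : ℝ :=
  ∑ i, ∑ j, ∑ k, (∑ l, P i l x * pderiv' l (P j k) x)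
    * pderiv' i f x * pderiv' j g x * pderiv' k h x

/-- The Hessian of `g` evaluated on the images under `P` of the differentials of `f` and `h`. -/
noncomputable def hessianTerm {n : ℕ} (P : Fin n → Fin n → ((Fin n → ℝ) → ℝ))
    (f g h : (Fin n → ℝ) → ℝ) (x : Fin n → ℝ) : ℝ :=
  ∑ i, ∑ l, ∑ j, ∑ k,
    P i l x * P j k x * pderiv' i f x * pderiv' l (pderiv' j g) x * pderiv' k h x

theorem hessianTerm_symm {n : ℕ} {P : Fin n → Fin n → ((Fin n → ℝ) → ℝ)}
    (hPanti : ∀ i j, P i j = fun x => -P j i x) (f : (Fin n → ℝ) → ℝ) {g : (Fin n → ℝ) → ℝ}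
    (hg : ContDiff ℝ (⊤ : ℕ∞) g) (h : (Fin n → ℝ) → ℝ) (x : Fin n → ℝ) :
    hessianTerm P h g f x = hessianTerm P f g h x := by
  unfold hessianTerm
  rw [sum_reverse_four]
  refine Finset.sum_congr rfl fun i _ => Finset.sum_congr rfl fun l _ =>
    Finset.sum_congr rfl fun j _ => Finset.sum_congr rfl fun k _ => ?_
  rw [congrFun (hPanti k j) x, congrFun (hPanti l i) x, pderiv'_comm hg j l]
  ring

theorem pbracket_pbracket {n : ℕ} {P : Fin n → Fin n → ((Fin n → ℝ) → ℝ)}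
    (hP : ∀ i j, ContDiff ℝ (⊤ : ℕ∞) (P i j)) (hPanti : ∀ i j, P i j = fun x => -P j i x)
    (f : (Fin n → ℝ) → ℝ) {g h : (Fin n → ℝ) → ℝ}
    (hg : ContDiff ℝ (⊤ : ℕ∞) g) (hh : ContDiff ℝ (⊤ : ℕ∞) h) (x : Fin n → ℝ) :
    pbracket P f (pbracket P g h) x
      = firstOrderTerm P f g h x + hessianTerm P f g h x - hessianTerm P f h g x := by
  have hfirst : firstOrderTerm P f g h x = ∑ i, ∑ l, ∑ j, ∑ k,
      P i l x * pderiv' i f x * (pderiv' l (P j k) x * pderiv' j g x * pderiv' k h x) := by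
    unfold firstOrderTerm
    refine Finset.sum_congr rfl fun i _ => ?_
    simp only [Finset.sum_mul]
    rw [sum_rotate_three, sum_rotate_three]
    refine Finset.sum_congr rfl fun l _ => Finset.sum_congr rfl fun j _ =>
      Finset.sum_congr rfl fun k _ => ?_
    ring
  have hhess : hessianTerm P f h g x = ∑ i, ∑ l, ∑ j, ∑ k,
      -(P i l x * pderiv' i f x * (P j k x * pderiv' j g x * pderiv' l (pderiv' k h) x)) := by
    unfold hessianTerm
    refine Finset.sum_congr rfl fun i _ => Finset.sum_congr rfl fun l _ => ?_
    rw [Finset.sum_comm]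
    refine Finset.sum_congr rfl fun j _ => Finset.sum_congr rfl fun k _ => ?_
    rw [congrFun (hPanti k j) x]
    ring
  rw [hfirst, hhess]
  simp only [pbracket.eq_def P f, pderiv'_pbracket hP hg hh, hessianTerm, Finset.mul_sum,
    ← Finset.sum_add_distrib, ← Finset.sum_sub_distrib]
  refine Finset.sum_congr rfl fun i _ => Finset.sum_congr rfl fun l _ =>
    Finset.sum_congr rfl fun j _ => Finset.sum_congr rfl fun k _ => ?_
  ring

theorem jacobiator_eq_schouten {n : ℕ}
    (P : Fin n → Fin n → ((Fin n → ℝ) → ℝ))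
    (hPsmooth : ∀ i j, ContDiff ℝ (⊤ : ℕ∞) (P i j))
    (hPanti : ∀ i j, P i j = fun x => -P j i x)
    (f g h : (Fin n → ℝ) → ℝ)
    (hf : ContDiff ℝ (⊤ : ℕ∞) f) (hg : ContDiff ℝ (⊤ : ℕ∞) g) (hh : ContDiff ℝ (⊤ : ℕ∞) h)
    (x : Fin n → ℝ) :
    pbracket P f (pbracket P g h) x + pbracket P g (pbracket P h f) x
      + pbracket P h (pbracket P f g) x
    = ∑ i, ∑ j, ∑ k,
        (∑ l, (P i l x * pderiv' l (P j k) x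
             + P j l x * pderiv' l (P k i) x
             + P k l x * pderiv' l (P i j) x))
        * pderiv' i f x * pderiv' j g x * pderiv' k h x := by
  rw [pbracket_pbracket hPsmooth hPanti f hg hh, pbracket_pbracket hPsmooth hPanti g hh hf,
    pbracket_pbracket hPsmooth hPanti h hf hg, hessianTerm_symm hPanti f hg h,
    hessianTerm_symm hPanti f hh g, hessianTerm_symm hPanti g hf h]
  have hghf : firstOrderTerm P g h f x = ∑ i, ∑ j, ∑ k,
      (∑ l, P j l x * pderiv' l (P k i) x)
        * pderiv' j g x * pderiv' k h x * pderiv' i f x := by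
    rw [firstOrderTerm, sum_rotate_three, sum_rotate_three]
  have hhfg : firstOrderTerm P h f g x = ∑ i, ∑ j, ∑ k,
      (∑ l, P k l x * pderiv' l (P i j) x)
        * pderiv' k h x * pderiv' i f x * pderiv' j g x := by
    rw [firstOrderTerm, sum_rotate_three]
  have hsum : firstOrderTerm P f g h x + firstOrderTerm P g h f x + firstOrderTerm P h f g x
      = ∑ i, ∑ j, ∑ k,
        (∑ l, (P i l x * pderiv' l (P j k) x
             + P j l x * pderiv' l (P k i) x
             + P k l x * pderiv' l (P i j) x))
        * pderiv' i f x * pderiv' j g x * pderiv' k h x := by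
    rw [hghf, hhfg, firstOrderTerm]
    simp only [← Finset.sum_add_distrib]
    refine Finset.sum_congr rfl fun i _ => Finset.sum_congr rfl fun j _ =>
      Finset.sum_congr rfl fun k _ => ?_
    simp only [Finset.sum_add_distrib]
    ring
  rw [← hsum]
  ring
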